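/- For every integer r ≥ 3 there exists a constant c_r > 0 such that every K_r-free finite simple graph with m edges has surplus at least c_r · m^(1/2 + 3/(4r−2)). -/

import Mathlib

namespace MaxCutPaper

variable {V : Type*}

/-- The size of the cut induced by a vertex subset `S`: the number of edges of `G`
with one endpoint in `S` and the other outside `S` (counted via ordered pairs with
first coordinate in `S`). -/
noncomputable def cutSize [Fintype V] (G : SimpleGraph V) (S : Finset V) : ℕ :=
  Nat.card {p : V × V // p.1 ∈ S ∧ p.2 ∉ S ∧ G.Adj p.1 p.2}

/-- The maximum size of a cut of `G`. -/
noncomputable def maxCut [Fintype V] (G : SimpleGraph V) : ℕ :=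
  (Finset.univ : Finset V).powerset.sup (cutSize G)

/-- The number of edges of `G`. -/
noncomputable def edgeCount (G : SimpleGraph V) : ℕ := Nat.card G.edgeSet

/-- The surplus of `G`: `mc(G) - e(G)/2`. -/
noncomputable def surplus [Fintype V] (G : SimpleGraph V) : ℝ :=
  (maxCut G : ℝ) - (edgeCount G : ℝ) / 2

/-- The degree of a vertex. -/
noncomputable def degC (G : SimpleGraph V) (v : V) : ℕ := Nat.card (G.neighborSet v)

/-- The number of copies of `K_r` in `G`, i.e. `r`-element sets of pairwise adjacent
vertices. -/
noncomputable def cliqueCount (G : SimpleGraph V) (r : ℕ) : ℕ :=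
  Nat.card {s : Finset V // G.IsNClique r s}

/-- `G` contains no cycle of length `r`. -/
def CycleFree (G : SimpleGraph V) (r : ℕ) : Prop :=
  ∀ ⦃v : V⦄ (w : G.Walk v v), w.IsCycle → w.length ≠ r

/-- `G` is `d`-degenerate (for a real `d ≥ 0`): every (induced) subgraph has a vertex of
degree at most `d`. -/
def Degenerate (G : SimpleGraph V) (d : ℝ) : Prop :=
  ∀ B : Finset V, B.Nonempty → ∃ v ∈ B, (Nat.card {u : V // u ∈ B ∧ G.Adj v u} : ℝ) ≤ d

/-- The number of edges of `G` with both endpoints in `T`. -/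
noncomputable def edgesIn (G : SimpleGraph V) (T : Finset V) : ℝ :=
  (Nat.card {p : V × V // p.1 ∈ T ∧ p.2 ∈ T ∧ G.Adj p.1 p.2} : ℝ) / 2

section Surplus

open Finset
open scoped Classical

/-- The quadratic form of the adjacency matrix of the subgraph induced on `U`. -/
noncomputable def quad (G : SimpleGraph V) (U : Finset V) (x : V → ℝ) : ℝ :=
  ∑ u ∈ U, ∑ v ∈ U, if G.Adj u v then x u * x v else 0

/-- The degree of `v` into `U`. -/
noncomputable def degIn (G : SimpleGraph V) (U : Finset V) (v : V) : ℕ :=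
  #{u ∈ U | G.Adj v u}

/-- Some fractional cut of the subgraph induced on `U` has (rescaled) surplus at least `s`. -/
def HasSurplus (G : SimpleGraph V) (U : Finset V) (s : ℝ) : Prop :=
  ∃ x : V → ℝ, (∀ v, |x v| ≤ 1) ∧ quad G U x ≤ -s

theorem HasSurplus.mono {G : SimpleGraph V} {U : Finset V} {s t : ℝ} (h : HasSurplus G U s)
    (hts : t ≤ s) : HasSurplus G U t := by
  obtain ⟨x, hx, hq⟩ := h
  exact ⟨x, hx, by linarith⟩

theorem hasSurplus_zero (G : SimpleGraph V) (U : Finset V) : HasSurplus G U 0 :=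
  ⟨0, by simp, by simp [quad]⟩

theorem quad_indicator {G : SimpleGraph V} {U W : Finset V} (h : U ⊆ W) (x : V → ℝ) :
    quad G W (fun v => if v ∈ U then x v else 0) = quad G U x := by
  unfold quad
  rw [← sum_subset h]
  · refine sum_congr rfl fun u hu => ?_
    rw [← sum_subset h]
    · exact sum_congr rfl fun v hv => by simp [hu, hv]
    · intro v _ hv
      simp [hv]
  · intro u _ hu
    simp [hu]

theorem HasSurplus.subset {G : SimpleGraph V} {U W : Finset V} {s : ℝ} (h : HasSurplus G U s)
    (hUW : U ⊆ W) : HasSurplus G W s := by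
  obtain ⟨x, hx, hq⟩ := h
  refine ⟨fun v => if v ∈ U then x v else 0, fun v => ?_, by rwa [quad_indicator hUW]⟩
  by_cases hv : v ∈ U <;> simp [hv, hx]

theorem quad_add_add_quad_sub (G : SimpleGraph V) (U : Finset V) (x y : V → ℝ) :
    quad G U (fun v => x v + y v) + quad G U (fun v => x v - y v)
      = 2 * quad G U x + 2 * quad G U y := by
  simp only [quad, mul_sum, ← sum_add_distrib]
  refine sum_congr rfl fun u _ => sum_congr rfl fun v _ => ?_
  split_ifs <;> ring

theorem HasSurplus.union {G : SimpleGraph V} {U W : Finset V} {s t : ℝ}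
    (hU : HasSurplus G U s) (hW : HasSurplus G W t) (hd : Disjoint U W) :
    HasSurplus G (U ∪ W) (s + t) := by
  obtain ⟨x, hx, hxq⟩ := hU
  obtain ⟨y, hy, hyq⟩ := hW
  set x' : V → ℝ := fun v => if v ∈ U then x v else 0 with hx'
  set y' : V → ℝ := fun v => if v ∈ W then y v else 0 with hy'
  have e1 : quad G (U ∪ W) x' = quad G U x := quad_indicator subset_union_left x
  have e2 : quad G (U ∪ W) y' = quad G W y := quad_indicator subset_union_right y
  have key := quad_add_add_quad_sub G (U ∪ W) x' y'
  have bd : ∀ v, |x' v + y' v| ≤ 1 ∧ |x' v - y' v| ≤ 1 := by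
    intro v
    by_cases hv : v ∈ U
    · have : v ∉ W := fun h => (disjoint_left.1 hd) hv h
      simp [hx', hy', hv, this, hx]
    · by_cases hw : v ∈ W <;> simp [hx', hy', hv, hw, hy]
  by_cases h : quad G (U ∪ W) (fun v => x' v + y' v) ≤ -(s + t)
  · exact ⟨_, fun v => (bd v).1, h⟩
  · exact ⟨_, fun v => (bd v).2, by linarith⟩

theorem hasSurplus_biUnion {ι : Type*} {G : SimpleGraph V} (I : Finset ι) (U : ι → Finset V)
    (s : ι → ℝ) (hd : (I : Set ι).PairwiseDisjoint U) (h : ∀ i ∈ I, HasSurplus G (U i) (s i)) :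
    HasSurplus G (I.biUnion U) (∑ i ∈ I, s i) := by
  induction I using Finset.induction_on with
  | empty => simpa using hasSurplus_zero G ∅
  | insert a I ha ih =>
    rw [biUnion_insert, sum_insert ha]
    refine (h a (mem_insert_self _ _)).union
      (ih (hd.subset (by simp)) fun i hi => h i (mem_insert_of_mem hi)) ?_
    rw [disjoint_biUnion_right]
    intro i hi
    exact hd (by simp) (by simp [hi]) (by rintro rfl; exact ha hi)

theorem abs_sub_le_add_abs (a b : ℝ) : |a - b| ≤ |a| + |b| := norm_sub_le a b

theorem exists_signed_sum {ι : Type*} (G : SimpleGraph V) (U : Finset V) (I : Finset ι)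
    (y : ι → V → ℝ) :
    ∃ z : V → ℝ, (∀ v, |z v| ≤ ∑ i ∈ I, |y i v|) ∧ quad G U z ≤ ∑ i ∈ I, quad G U (y i) := by
  induction I using Finset.induction_on with
  | empty => exact ⟨0, by simp, by simp [quad]⟩
  | insert a I ha ih =>
    obtain ⟨z, hz, hq⟩ := ih
    simp only [sum_insert ha]
    have key := quad_add_add_quad_sub G U (y a) z
    by_cases h : quad G U (fun v => y a v + z v) ≤ quad G U (y a) + ∑ i ∈ I, quad G U (y i)
    · exact ⟨_, fun v => (abs_add_le _ _).trans (by linarith [hz v]), h⟩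
    · exact ⟨_, fun v => (abs_sub_le_add_abs (y a v) (z v)).trans (by linarith [hz v]), by linarith⟩

theorem hasSurplus_of_average {Ω : Type*} [Fintype Ω] [Nonempty Ω] {G : SimpleGraph V}
    {U : Finset V} {s : ℝ} (x : Ω → V → ℝ) (hx : ∀ ω v, |x ω v| ≤ 1)
    (h : ∑ ω, quad G U (x ω) ≤ -(Fintype.card Ω * s)) : HasSurplus G U s := by
  by_contra hcon
  have h1 : ∀ ω ∈ (univ : Finset Ω), -s < quad G U (x ω) := by
    intro ω _
    by_contra hle
    exact hcon ⟨x ω, hx ω, not_lt.1 hle⟩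
  have := sum_lt_sum_of_nonempty univ_nonempty h1
  simp at this
  linarith

theorem sum_quad {Ω : Type*} [Fintype Ω] (G : SimpleGraph V) (U : Finset V) (x : Ω → V → ℝ) :
    ∑ ω, quad G U (x ω) = ∑ u ∈ U, ∑ v ∈ U, if G.Adj u v then ∑ ω, x ω u * x ω v else 0 := by
  unfold quad
  rw [sum_comm]
  refine sum_congr rfl fun u _ => ?_
  rw [sum_comm]
  refine sum_congr rfl fun v _ => ?_
  split_ifs <;> simp

theorem sum_adj_mem_eq_card {G : SimpleGraph V} {U : Finset V} {L : V → Finset V} {v : V}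
    (hLU : L v ⊆ U) (hadj : ∀ a ∈ L v, G.Adj v a) :
    ∑ u ∈ U, (if G.Adj u v then (if u ∈ L v then (1 : ℝ) else 0) else 0) = #(L v) := by
  have : ∀ u, (if G.Adj u v then (if u ∈ L v then (1 : ℝ) else 0) else 0)
      = if u ∈ L v then 1 else 0 := by
    intro u
    by_cases h : u ∈ L v
    · simp [h, (hadj u h).symm]
    · simp [h]
  simp only [this]
  rw [sum_ite_mem, inter_eq_right.2 hLU]
  simp

theorem exists_sign_le_quad {G : SimpleGraph V} (U A : Finset V) (x : V → ℝ)
    (hx : ∀ v, |x v| ≤ 1) :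
    ∃ y : V → ℝ, (∀ v, |y v| ≤ 1) ∧ (∀ v ∈ A, y v = 1 ∨ y v = -1) ∧ quad G U y ≤ quad G U x := by
  induction A using Finset.induction_on with
  | empty => exact ⟨x, hx, by simp, le_rfl⟩
  | insert a A ha ih =>
    obtain ⟨y, hy, hyA, hq⟩ := ih
    have key : quad G U y = (1 + y a) / 2 * quad G U (Function.update y a 1)
        + (1 - y a) / 2 * quad G U (Function.update y a (-1)) := by
      simp only [quad, mul_sum, ← sum_add_distrib]
      refine sum_congr rfl fun u _ => sum_congr rfl fun v _ => ?_
      split_ifs with huv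
      · have hne := huv.ne
        by_cases h1 : u = a
        · subst h1
          simp [hne.symm]; ring
        · by_cases h2 : v = a
          · subst h2
            simp [hne]; ring
          · simp [h1, h2]; ring
      · simp
    have hya := abs_le.1 (hy a)
    have fin : ∀ c : ℝ, (c = 1 ∨ c = -1) → quad G U (Function.update y a c) ≤ quad G U y →
        ∃ z : V → ℝ, (∀ v, |z v| ≤ 1) ∧ (∀ v ∈ insert a A, z v = 1 ∨ z v = -1) ∧
          quad G U z ≤ quad G U x := by
      intro c hc hle
      refine ⟨Function.update y a c, fun v => ?_, fun v hv => ?_, hle.trans hq⟩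
      · by_cases h : v = a
        · subst h
          rcases hc with rfl | rfl <;> simp
        · simp [h, hy]
      · by_cases h : v = a
        · subst h; simpa using hc
        · simpa [h] using hyA v ((mem_insert.1 hv).resolve_left h)
    by_cases h : quad G U (Function.update y a 1) ≤ quad G U y
    · exact fin 1 (Or.inl rfl) h
    · refine fin (-1) (Or.inr rfl) ?_
      by_contra h'
      push Not at h h'
      nlinarith [mul_nonneg (by linarith : (0:ℝ) ≤ 1 + y a) (sub_nonneg.2 h.le),
        mul_nonneg (by linarith : (0:ℝ) ≤ 1 - y a) (sub_nonneg.2 h'.le)]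

theorem sum_degIn_univ [Fintype V] (G : SimpleGraph V) :
    ∑ v, (degIn G univ v : ℝ) = 2 * edgeCount G := by
  have h := G.sum_degrees_eq_twice_card_edges
  have h2 : edgeCount G = #G.edgeFinset := by
    rw [edgeCount, Nat.card_eq_fintype_card, SimpleGraph.edgeFinset_card]
  rw [h2]
  have h3 : ∀ v, degIn G univ v = G.degree v := by
    intro v
    rw [← SimpleGraph.card_neighborFinset_eq_degree, SimpleGraph.neighborFinset_eq_filter]
    rfl
  simp only [h3]
  exact_mod_cast h

theorem cutSize_eq_sum [Fintype V] (G : SimpleGraph V) (S : Finset V) :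
    (cutSize G S : ℝ) = ∑ u, ∑ v, if G.Adj u v then (if u ∈ S ∧ v ∉ S then (1 : ℝ) else 0) else 0 := by
  rw [cutSize, Nat.card_eq_fintype_card, Fintype.card_subtype, ← Fintype.sum_prod_type'
    (f := fun u v => if G.Adj u v then (if u ∈ S ∧ v ∉ S then (1 : ℝ) else 0) else 0)]
  rw [card_filter]
  push_cast
  refine sum_congr rfl fun p _ => ?_
  by_cases h1 : p.1 ∈ S <;> by_cases h2 : p.2 ∈ S <;> simp [h1, h2]

theorem HasSurplus.le_surplus [Fintype V] {G : SimpleGraph V} {s : ℝ}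
    (h : HasSurplus G univ s) : s / 4 ≤ surplus G := by
  obtain ⟨x, hx, hq⟩ := h
  obtain ⟨y, -, hy', hyq⟩ := exists_sign_le_quad (G := G) univ univ x hx
  have hy : ∀ v, y v = 1 ∨ y v = -1 := fun v => hy' v (mem_univ v)
  clear hy'
  set S : Finset V := {v | y v = 1} with hS
  have e : quad G univ y = 2 * edgeCount G - 4 * cutSize G S := by
    have hsymm : (cutSize G S : ℝ)
        = ∑ u, ∑ v, if G.Adj u v then (if v ∈ S ∧ u ∉ S then (1 : ℝ) else 0) else 0 := by
      rw [cutSize_eq_sum, sum_comm]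
      refine sum_congr rfl fun u _ => sum_congr rfl fun v _ => ?_
      rw [G.adj_comm]
    have : (4 * cutSize G S : ℝ) = 2 * cutSize G S + 2 * cutSize G S := by ring
    rw [this]
    nth_rewrite 1 [cutSize_eq_sum]
    rw [hsymm, ← sum_degIn_univ]
    simp only [degIn, card_filter, Nat.cast_sum, mul_sum, ← sum_add_distrib, ← sum_sub_distrib, quad]
    refine sum_congr rfl fun u _ => sum_congr rfl fun v _ => ?_
    split_ifs with h1 h2 h3 h3 <;> simp only [hS, mem_filter, mem_univ, true_and] at * <;>
    rcases hy u with hu | hu <;> rcases hy v with hv | hv <;> simp_all <;> norm_num at *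
  have hle : (cutSize G S : ℝ) ≤ maxCut G := by
    exact_mod_cast Finset.le_sup (f := cutSize G) (by simp : S ∈ (univ : Finset V).powerset)
  unfold surplus
  linarith

end Surplus

section RandomSigns

open Finset
open scoped Classical

variable [Fintype V]

/-- The value of a linear form at a sign vector. -/
noncomputable def signSum (a : V → ℝ) (σ : V → Bool) : ℝ :=
  ∑ v, a v * (if σ v then 1 else -1)

theorem sum_cos_signSum (a : V → ℝ) :
    ∑ σ : V → Bool, Real.cos (signSum a σ) = 2 ^ Fintype.card V * ∏ v, Real.cos (a v) := by
  have h1 : ∀ σ : V → Bool, Real.cos (signSum a σ)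
      = (∏ v, Complex.exp ((a v * (if σ v then 1 else -1) : ℝ) * Complex.I)).re := by
    intro σ
    rw [← Complex.exp_sum, ← sum_mul, ← Complex.ofReal_sum, Complex.exp_ofReal_mul_I_re]
    rfl
  have h2 := Finset.prod_univ_sum (fun _ : V => (univ : Finset Bool))
    (fun v b => Complex.exp ((a v * (if b then 1 else -1) : ℝ) * Complex.I))
  rw [Fintype.piFinset_univ] at h2
  simp only [h1]
  rw [← Complex.re_sum, ← h2]
  have h3 : ∀ v, ∑ b : Bool, Complex.exp ((a v * (if b then 1 else -1) : ℝ) * Complex.I)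
      = ((2 * Real.cos (a v) : ℝ) : ℂ) := by
    intro v
    rw [Fintype.sum_bool]
    push_cast
    rw [Complex.two_cos]
    simp
  simp only [h3]
  rw [← Complex.ofReal_prod, Complex.ofReal_re, prod_mul_distrib]
  simp

theorem sum_sin_mul_sin (a b : V → ℝ) :
    ∑ σ : V → Bool, Real.sin (signSum a σ) * Real.sin (signSum b σ)
      = 2 ^ Fintype.card V *
        ((∏ v, Real.cos (a v - b v) - ∏ v, Real.cos (a v + b v)) / 2) := by
  have h : ∀ σ : V → Bool, Real.sin (signSum a σ) * Real.sin (signSum b σ)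
      = (Real.cos (signSum (fun v => a v - b v) σ)
        - Real.cos (signSum (fun v => a v + b v) σ)) / 2 := by
    intro σ
    have e1 : signSum (fun v => a v - b v) σ = signSum a σ - signSum b σ := by
      simp only [signSum, sub_mul, sum_sub_distrib]
    have e2 : signSum (fun v => a v + b v) σ = signSum a σ + signSum b σ := by
      simp only [signSum, add_mul, sum_add_distrib]
    rw [e1, e2, Real.cos_sub, Real.cos_add]
    ring
  simp only [h]
  rw [← sum_div, sum_sub_distrib, sum_cos_signSum, sum_cos_signSum]
  ring

theorem sum_sin_single_mul_sin (u : V) (b : V → ℝ) :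
    ∑ σ : V → Bool,
        Real.sin (signSum (Pi.single u (Real.pi / 2)) σ) * Real.sin (signSum b σ)
      = 2 ^ Fintype.card V * (Real.sin (b u) * ∏ v ∈ univ.erase u, Real.cos (b v)) := by
  rw [sum_sin_mul_sin]
  congr 1
  rw [← mul_prod_erase univ _ (mem_univ u), ← mul_prod_erase univ _ (mem_univ u)]
  have e1 : ∏ v ∈ univ.erase u, Real.cos ((Pi.single u (Real.pi / 2) : V → ℝ) v - b v)
      = ∏ v ∈ univ.erase u, Real.cos (b v) := by
    refine prod_congr rfl fun v hv => ?_
    rw [Pi.single_eq_of_ne (ne_of_mem_erase hv), zero_sub, Real.cos_neg]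
  have e2 : ∏ v ∈ univ.erase u, Real.cos ((Pi.single u (Real.pi / 2) : V → ℝ) v + b v)
      = ∏ v ∈ univ.erase u, Real.cos (b v) := by
    refine prod_congr rfl fun v hv => ?_
    rw [Pi.single_eq_of_ne (ne_of_mem_erase hv), zero_add]
  rw [e1, e2, Pi.single_eq_same, Real.cos_pi_div_two_sub, add_comm (Real.pi / 2),
    Real.cos_add_pi_div_two]
  ring

/-- The multiple `ε` of the indicator function of `L`. -/
noncomputable def scaledInd (ε : ℝ) (L : Finset V) (v : V) : ℝ := if v ∈ L then ε else 0

theorem sum_sin_ind_mul_sin_ind_le (ε : ℝ) (L M : Finset V) :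
    ∑ σ : V → Bool,
        Real.sin (signSum (scaledInd ε L) σ) * Real.sin (signSum (scaledInd ε M) σ)
      ≤ 2 ^ Fintype.card V * (ε ^ 2 * #(L ∩ M)) := by
  rw [sum_sin_mul_sin]
  refine mul_le_mul_of_nonneg_left ?_ (by positivity)
  set p : V → ℝ := fun v => Real.cos (scaledInd ε L v - scaledInd ε M v)
  have e : ∏ v, Real.cos (scaledInd ε L v + scaledInd ε M v)
      = (∏ v, p v) * Real.cos (2 * ε) ^ #(L ∩ M) := by
    have : Real.cos (2 * ε) ^ #(L ∩ M) = ∏ v, if v ∈ L ∩ M then Real.cos (2 * ε) else 1 := by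
      rw [prod_ite_mem, univ_inter, prod_const]
    rw [this, ← prod_mul_distrib]
    refine prod_congr rfl fun v _ => ?_
    by_cases h1 : v ∈ L <;> by_cases h2 : v ∈ M <;> simp [p, scaledInd, h1, h2, two_mul]
  rw [e]
  have hp : |∏ v, p v| ≤ 1 := by
    rw [abs_prod]
    exact prod_le_one (fun _ _ => abs_nonneg _) fun _ _ => Real.abs_cos_le_one _
  have hb : 1 + (#(L ∩ M) : ℝ) * (Real.cos (2 * ε) - 1) ≤ Real.cos (2 * ε) ^ #(L ∩ M) := by
    have := one_add_mul_le_pow (a := Real.cos (2 * ε) - 1)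
      (by linarith [Real.neg_one_le_cos (2 * ε)]) #(L ∩ M)
    simpa using this
  have hc : 1 - 2 * ε ^ 2 ≤ Real.cos (2 * ε) := by
    have := Real.one_sub_sq_div_two_le_cos (x := 2 * ε)
    linarith
  have hq : Real.cos (2 * ε) ^ #(L ∩ M) ≤ 1 := by
    refine (le_abs_self _).trans ?_
    rw [abs_pow]
    exact pow_le_one₀ (abs_nonneg _) (Real.abs_cos_le_one _)
  have hk : (0 : ℝ) ≤ #(L ∩ M) := by positivity
  nlinarith [abs_le.1 hp, mul_nonneg hk (sub_nonneg.2 hc),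
    mul_nonneg (sub_nonneg.2 (abs_le.1 hp).2) (sub_nonneg.2 hq)]

theorem le_sum_sin_single_mul_sin_ind {ε : ℝ} (hε : 0 < ε) {L : Finset V} (hε1 : ε ≤ 1)
    (hL : ε ^ 2 * #L ≤ 1) (u : V) :
    2 ^ Fintype.card V * (3 / 8 * ε * if u ∈ L then 1 else 0) ≤ ∑ σ : V → Bool,
      Real.sin (signSum (Pi.single u (Real.pi / 2)) σ) * Real.sin (signSum (scaledInd ε L) σ) := by
  rw [sum_sin_single_mul_sin]
  refine mul_le_mul_of_nonneg_left ?_ (by positivity)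
  by_cases hu : u ∈ L
  · have e : ∏ v ∈ univ.erase u, Real.cos (scaledInd ε L v) = Real.cos ε ^ #(L.erase u) := by
      have : ∀ v, Real.cos (scaledInd ε L v) = if v ∈ L then Real.cos ε else 1 := by
        intro v
        unfold scaledInd
        split_ifs <;> simp
      simp only [this]
      rw [prod_ite_mem, prod_const, erase_inter, univ_inter]
    have hc := Real.one_sub_sq_div_two_le_cos (x := ε)
    have hb : 1 + (#(L.erase u) : ℝ) * (Real.cos ε - 1) ≤ Real.cos ε ^ #(L.erase u) := by
      have := one_add_mul_le_pow (a := Real.cos ε - 1)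
        (by linarith [Real.neg_one_le_cos ε]) #(L.erase u)
      simpa using this
    have hcard : (#(L.erase u) : ℝ) ≤ #L := by exact_mod_cast card_le_card (erase_subset _ _)
    have h0 : (0 : ℝ) ≤ #(L.erase u) := by positivity
    have hpow : 1 / 2 ≤ Real.cos ε ^ #(L.erase u) := by
      nlinarith [mul_nonneg h0 (sub_nonneg.2 hc),
        mul_nonneg (sq_nonneg ε) (sub_nonneg.2 hcard)]
    have hs : ε - ε ^ 3 / 6 < Real.sin ε := Real.sin_gt_sub_cube hε
    have hs' : 3 / 4 * ε ≤ Real.sin ε := by nlinarith [mul_pos hε hε]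
    rw [e, if_pos hu, scaledInd, if_pos hu]
    nlinarith
  · simp [hu, scaledInd]

end RandomSigns

section Stars

open Finset
open scoped Classical

variable [Fintype V]

theorem hasSurplus_of_stars {G : SimpleGraph V} {U : Finset V} (L : V → Finset V) {ε τ : ℝ}
    (hε : 0 < ε) (hε1 : ε ≤ 1) (hLU : ∀ v, L v ⊆ U) (hadj : ∀ v, ∀ a ∈ L v, G.Adj v a)
    (hcard : ∀ v, ε ^ 2 * #(L v) ≤ 1)
    (hcodeg : ∑ u ∈ U, ∑ v ∈ U, (if G.Adj u v then (#(L u ∩ L v) : ℝ) else 0)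
      ≤ τ * ∑ v ∈ U, (#(L v) : ℝ)) :
    HasSurplus G U ((3 / 16 * ε - ε ^ 2 * τ / 4) * ∑ v ∈ U, (#(L v) : ℝ)) := by
  set ℓ : ℝ := ∑ v ∈ U, (#(L v) : ℝ)
  set A : V → (V → Bool) → ℝ := fun v σ => Real.sin (signSum (Pi.single v (Real.pi / 2)) σ)
  set B : V → (V → Bool) → ℝ := fun v σ => Real.sin (signSum (scaledInd ε (L v)) σ)
  have hA : ∀ v σ, |A v σ| ≤ 1 := fun v σ => Real.abs_sin_le_one _
  have hB : ∀ v σ, |B v σ| ≤ 1 := fun v σ => Real.abs_sin_le_one _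
  refine hasSurplus_of_average (fun (σ : V → Bool) v => (A v σ - B v σ) / 2) (fun σ v => ?_) ?_
  · have h1 := abs_le.1 (hA v σ)
    have h2 := abs_le.1 (hB v σ)
    rw [abs_le]
    constructor <;> linarith
  rw [sum_quad]
  set N : ℝ := 2 ^ Fintype.card V
  have hN : 0 < N := by positivity
  have hpair : ∀ u v, G.Adj u v → ∑ σ, (A u σ - B u σ) / 2 * ((A v σ - B v σ) / 2)
      ≤ N / 4 * (ε ^ 2 * #(L u ∩ L v) - 3 / 8 * ε * (if u ∈ L v then 1 else 0)
        - 3 / 8 * ε * (if v ∈ L u then 1 else 0)) := by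
    intro u v huv
    have e : ∑ σ, (A u σ - B u σ) / 2 * ((A v σ - B v σ) / 2)
        = (∑ σ, A u σ * A v σ - ∑ σ, A u σ * B v σ - ∑ σ, A v σ * B u σ
          + ∑ σ, B u σ * B v σ) / 4 := by
      rw [← sum_sub_distrib, ← sum_sub_distrib, ← sum_add_distrib, sum_div]
      exact sum_congr rfl fun σ _ => by ring
    have h1 : ∑ σ, A u σ * A v σ = 0 := by
      have := sum_sin_single_mul_sin u (Pi.single v (Real.pi / 2))
      rw [Pi.single_eq_of_ne huv.ne, Real.sin_zero, zero_mul, mul_zero] at this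
      exact this
    have h2 := le_sum_sin_single_mul_sin_ind hε hε1 (hcard v) u
    have h3 := le_sum_sin_single_mul_sin_ind hε hε1 (hcard u) v
    have h4 := sum_sin_ind_mul_sin_ind_le ε (L u) (L v)
    rw [e, h1]
    change _ ≤ ∑ σ, A u σ * B v σ at h2
    change _ ≤ ∑ σ, A v σ * B u σ at h3
    change ∑ σ, B u σ * B v σ ≤ _ at h4
    change N * _ ≤ _ at h2
    change N * _ ≤ _ at h3
    change _ ≤ N * _ at h4
    linarith
  have hsum : ∑ u ∈ U, ∑ v ∈ U,
      (if G.Adj u v then ∑ σ, (A u σ - B u σ) / 2 * ((A v σ - B v σ) / 2) else 0)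
      ≤ ∑ u ∈ U, ∑ v ∈ U, (N / 4 * ε ^ 2 * (if G.Adj u v then (#(L u ∩ L v) : ℝ) else 0)
        - N / 4 * (3 / 8 * ε) * (if G.Adj u v then (if u ∈ L v then (1 : ℝ) else 0) else 0)
        - N / 4 * (3 / 8 * ε) * (if G.Adj v u then (if v ∈ L u then (1 : ℝ) else 0) else 0)) := by
    refine sum_le_sum fun u _ => sum_le_sum fun v _ => ?_
    by_cases h : G.Adj u v
    · simp only [h, h.symm, if_true]
      linarith [hpair u v h]
    · have h' : ¬ G.Adj v u := fun hh => h hh.symm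
      simp [h, h']
  refine hsum.trans ?_
  simp only [sum_sub_distrib, ← mul_sum]
  have h5 : ∑ u ∈ U, ∑ v ∈ U, (if G.Adj v u then (if v ∈ L u then (1 : ℝ) else 0) else 0) = ℓ :=
    sum_congr rfl fun u _ => sum_adj_mem_eq_card (hLU u) (hadj u)
  have h6 : ∑ u ∈ U, ∑ v ∈ U, (if G.Adj u v then (if u ∈ L v then (1 : ℝ) else 0) else 0) = ℓ := by
    rw [sum_comm]
    exact h5
  rw [h5, h6]
  have h7 : (Fintype.card (V → Bool) : ℝ) = N := by simp [N]
  rw [h7]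
  have h8 := mul_le_mul_of_nonneg_left hcodeg (by positivity : 0 ≤ N / 4 * ε ^ 2)
  nlinarith

end Stars

section Sampling

open Finset
open scoped Classical

variable [Fintype V]

theorem card_functions_eq_zero_on (K : ℕ) [NeZero K] (S : Finset V) :
    #{f : V → Fin K | ∀ x ∈ S, f x = 0} * K ^ #S = K ^ Fintype.card V := by
  have e : ({f : V → Fin K | ∀ x ∈ S, f x = 0} : Finset (V → Fin K))
      = Fintype.piFinset fun x => if x ∈ S then {0} else univ := by
    ext f
    simp only [mem_filter, mem_univ, true_and, Fintype.mem_piFinset]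
    refine forall_congr' fun x => ?_
    by_cases h : x ∈ S <;> simp [h]
  rw [e, Fintype.card_piFinset]
  have e2 : K ^ #S = ∏ x, if x ∈ S then K else 1 := by
    rw [prod_ite_mem, univ_inter, prod_const]
  rw [e2, ← prod_mul_distrib, Fintype.card, ← prod_const]
  refine prod_congr rfl fun x _ => ?_
  by_cases h : x ∈ S <;> simp [h]

/-- The vertices `v` for which `w` is the only element of `D v` sampled by `f`. -/
noncomputable def cell {K : ℕ} [NeZero K] (H : Finset V) (D : V → Finset V) (f : V → Fin K)
    (w : V) : Finset V :=
  {v ∈ H | w ∈ D v ∧ ∀ a ∈ D v, f a = 0 → a = w}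

theorem card_conflict_le {t K : ℕ} [NeZero K] (hK : K = 8 * t) {M : Finset V} (hM : #M ≤ t)
    (w : V) :
    (#{f : V → Fin K | f w = 0 ∧ ¬ ∀ a ∈ M, f a = 0 → a = w} : ℝ)
      ≤ (K : ℝ) ^ Fintype.card V / K / 8 := by
  have hK0 : (0 : ℝ) < K := by exact_mod_cast Nat.pos_of_ne_zero (NeZero.ne K)
  have hsub : ({f : V → Fin K | f w = 0 ∧ ¬ ∀ a ∈ M, f a = 0 → a = w} : Finset (V → Fin K))
      ⊆ (M.erase w).biUnion fun a => {f : V → Fin K | ∀ x ∈ ({w, a} : Finset V), f x = 0} := by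
    intro f hf
    simp only [mem_filter, mem_univ, true_and] at hf
    obtain ⟨h0, h1⟩ := hf
    push Not at h1
    obtain ⟨a, ha, hfa, haw⟩ := h1
    simp only [mem_biUnion, mem_erase, mem_filter, mem_univ, true_and]
    exact ⟨a, ⟨haw, ha⟩, by simp [h0, hfa]⟩
  have h2 : ∀ a ∈ M.erase w,
      (#{f : V → Fin K | ∀ x ∈ ({w, a} : Finset V), f x = 0} : ℝ)
        = (K : ℝ) ^ Fintype.card V / (K : ℝ) ^ 2 := by
    intro a ha
    have := card_functions_eq_zero_on K ({w, a} : Finset V)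
    rw [card_pair (ne_of_mem_erase ha).symm] at this
    rw [eq_div_iff (by positivity)]
    exact_mod_cast this
  have h3 : (#{f : V → Fin K | f w = 0 ∧ ¬ ∀ a ∈ M, f a = 0 → a = w} : ℝ)
      ≤ ∑ a ∈ M.erase w, (#{f : V → Fin K | ∀ x ∈ ({w, a} : Finset V), f x = 0} : ℝ) := by
    exact_mod_cast (card_le_card hsub).trans card_biUnion_le
  rw [sum_congr rfl h2, sum_const, nsmul_eq_mul] at h3
  refine h3.trans ?_
  have h4 : (#(M.erase w) : ℝ) ≤ t := by
    exact_mod_cast (card_le_card (erase_subset _ _)).trans hM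
  have h5 : (K : ℝ) = 8 * t := by exact_mod_cast hK
  calc (#(M.erase w) : ℝ) * ((K : ℝ) ^ Fintype.card V / (K : ℝ) ^ 2)
      ≤ (K / 8) * ((K : ℝ) ^ Fintype.card V / (K : ℝ) ^ 2) := by
        refine mul_le_mul_of_nonneg_right ?_ (by positivity)
        linarith
    _ = (K : ℝ) ^ Fintype.card V / K / 8 := by
        field_simp

theorem card_good_ge {t K : ℕ} [NeZero K] (hK : K = 8 * t) {H : Finset V} {D : V → Finset V}
    (hD : ∀ v, #(D v) ≤ t) {w v : V} (hv : v ∈ H) (hwv : w ∈ D v) {N : Finset V}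
    (hN : ∀ u ∈ N, u ∈ H ∧ w ∈ D u) :
    5 / 8 * ((K : ℝ) ^ Fintype.card V / K) ≤
      #{f : V → Fin K | f w = 0 ∧ v ∈ cell H D f w ∧ #N ≤ 2 * #{u ∈ N | u ∈ cell H D f w}} := by
  set Q : ℝ := (K : ℝ) ^ Fintype.card V / K
  have hK0 : (0 : ℝ) < K := by exact_mod_cast Nat.pos_of_ne_zero (NeZero.ne K)
  set bad : V → Finset (V → Fin K) := fun u => {f | f w = 0 ∧ ¬ ∀ a ∈ D u, f a = 0 → a = w}
  have hbad : ∀ u, (#(bad u) : ℝ) ≤ Q / 8 := fun u => card_conflict_le hK (hD u) w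
  set Ω : Finset (V → Fin K) := {f | f w = 0} with hΩ
  have hΩc : (#Ω : ℝ) = Q := by
    have := card_functions_eq_zero_on K ({w} : Finset V)
    simp only [mem_singleton, forall_eq, card_singleton, pow_one] at this
    rw [eq_div_iff hK0.ne']
    exact_mod_cast this
  set good : Finset (V → Fin K) :=
    {f : V → Fin K | f w = 0 ∧ v ∈ cell H D f w ∧ #N ≤ 2 * #{u ∈ N | u ∈ cell H D f w}}
  have hbadsub : ∀ u, bad u ⊆ Ω := fun u f hf => by
    simp only [bad, hΩ, mem_filter, mem_univ, true_and] at hf ⊢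
    exact hf.1
  have hpt : ∀ f ∈ Ω, (#N : ℝ) ≤ #N * (if f ∈ good then 1 else 0)
      + #N * (if f ∈ bad v then 1 else 0) + 2 * ∑ u ∈ N, (if f ∈ bad u then (1 : ℝ) else 0) := by
    intro f hf
    have hf0 : f w = 0 := by simpa [hΩ] using hf
    have hs0 : (0 : ℝ) ≤ ∑ u ∈ N, (if f ∈ bad u then (1 : ℝ) else 0) :=
      sum_nonneg fun u _ => by split_ifs <;> norm_num
    have hN0 : (0 : ℝ) ≤ #N := by positivity
    by_cases hfv : f ∈ bad v
    · have : (0 : ℝ) ≤ if f ∈ good then (1 : ℝ) else 0 := by split_ifs <;> norm_num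
      simp only [hfv, if_true]
      nlinarith
    by_cases hg : f ∈ good
    · simp only [hg, hfv, if_true, if_false]
      linarith
    have hvc : v ∈ cell H D f w := by
      simp only [bad, mem_filter, mem_univ, true_and, hf0, not_not] at hfv
      simp only [cell, mem_filter]
      exact ⟨hv, hwv, hfv⟩
    have hlt : 2 * #{u ∈ N | u ∈ cell H D f w} < #N := by
      by_contra h
      exact hg (by simp only [good, mem_filter, mem_univ, true_and]; exact ⟨hf0, hvc, by omega⟩)
    have hc : #{u ∈ N | u ∈ cell H D f w} + #{u ∈ N | f ∈ bad u} = #N := by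
      rw [← card_filter_add_card_filter_not (s := N) (fun u => u ∈ cell H D f w)]
      congr 2
      refine filter_congr fun u hu => ?_
      simp [cell, bad, hf0, (hN u hu).1, (hN u hu).2]
    have hc' : ∑ u ∈ N, (if f ∈ bad u then (1 : ℝ) else 0) = #{u ∈ N | f ∈ bad u} := by
      rw [sum_boole]
    rw [hc']
    have : (#N : ℝ) ≤ 2 * #{u ∈ N | f ∈ bad u} := by
      exact_mod_cast (by omega : #N ≤ 2 * #{u ∈ N | f ∈ bad u})
    simp only [hg, hfv, if_false]
    linarith
  have hsum := sum_le_sum hpt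
  simp only [sum_add_distrib, ← mul_sum, sum_const, nsmul_eq_mul] at hsum
  rw [sum_comm] at hsum
  have hind : ∀ A : Finset (V → Fin K), A ⊆ Ω →
      ∑ f ∈ Ω, (if f ∈ A then (1 : ℝ) else 0) = #A := by
    intro A hA
    rw [sum_ite_mem, inter_eq_right.2 hA]
    simp
  have hgoodsub : good ⊆ Ω := fun f hf => by
    simp only [good, hΩ, mem_filter, mem_univ, true_and] at hf ⊢
    exact hf.1
  rw [hind good hgoodsub, hind _ (hbadsub v), sum_congr rfl fun u _ => hind _ (hbadsub u),
    hΩc] at hsum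
  by_cases hN0 : #N = 0
  · have : ((bad v)ᶜ ∩ Ω : Finset (V → Fin K)) ⊆ good := by
      intro f hf
      simp only [mem_inter, mem_compl, bad, hΩ, mem_filter, mem_univ, true_and] at hf
      simp only [good, mem_filter, mem_univ, true_and, hN0, Nat.zero_le, and_true, cell]
      exact ⟨hf.2, hv, hwv, by
        have := hf.1
        simp only [hf.2, true_and, not_not] at this
        exact this⟩
    have h1 : Ω ⊆ bad v ∪ good := fun f hf => by
      by_cases h : f ∈ bad v
      · exact mem_union_left _ h
      · exact mem_union_right _ (this (by simp [h, hf]))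
    have h2 : (#Ω : ℝ) ≤ #(bad v) + #good := by
      exact_mod_cast (card_le_card h1).trans (card_union_le _ _)
    have := hbad v
    have hQ : 0 ≤ Q := by positivity
    linarith
  · have hNp : (0 : ℝ) < #N := by exact_mod_cast Nat.pos_of_ne_zero hN0
    have h1 : ∑ u ∈ N, (#(bad u) : ℝ) ≤ #N * (Q / 8) := by
      refine (sum_le_sum fun u _ => hbad u).trans ?_
      simp
    have h2 := mul_le_mul_of_nonneg_left (hbad v) hNp.le
    have h3 : (#N : ℝ) * (5 / 8 * Q) ≤ #N * #good := by nlinarith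
    exact le_of_mul_le_mul_left h3 hNp

theorem exists_cells {G : SimpleGraph V} (H : Finset V) (D : V → Finset V) {t : ℕ} (ht : 1 ≤ t)
    (hD : ∀ v, #(D v) ≤ t) (τ : ℝ) :
    ∃ (W : Finset V) (C : V → Finset V), (∀ w ∈ W, C w ⊆ {v ∈ H | w ∈ D v}) ∧
      (W : Set V).PairwiseDisjoint C ∧
      5 / (64 * t) * ∑ v ∈ H, (#{w ∈ D v | τ ≤ degIn G {u ∈ H | w ∈ D u} v} : ℝ) ≤
        ∑ w ∈ W, (#{v ∈ C w | τ ≤ 2 * degIn G (C w) v} : ℝ) := by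
  set K := 8 * t with hK
  have : NeZero K := ⟨by omega⟩
  have hK0 : (0 : ℝ) < K := by exact_mod_cast Nat.pos_of_ne_zero (NeZero.ne K)
  set Q : ℝ := (K : ℝ) ^ Fintype.card V / K with hQ
  set ℓ : ℝ := ∑ v ∈ H, (#{w ∈ D v | τ ≤ degIn G {u ∈ H | w ∈ D u} v} : ℝ) with hℓ
  set g : (V → Fin K) → ℝ := fun f => ∑ w with f w = 0,
    (#{v ∈ cell H D f w | τ ≤ 2 * degIn G (cell H D f w) v} : ℝ)
  have hmain : 5 / 8 * Q * ℓ ≤ ∑ f, g f := by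
    have e1 : ∑ f, g f = ∑ v ∈ H, ∑ w, (#{f : V → Fin K | f w = 0 ∧ v ∈ cell H D f w ∧
        τ ≤ 2 * degIn G (cell H D f w) v} : ℝ) := by
      rw [sum_comm]
      simp only [g, card_filter, Nat.cast_sum, sum_filter]
      rw [sum_comm]
      refine sum_congr rfl fun w _ => ?_
      rw [sum_comm]
      refine sum_congr rfl fun f _ => ?_
      by_cases h0 : f w = 0
      · simp only [h0, if_true, true_and]
        rw [← sum_subset (filter_subset _ H : cell H D f w ⊆ H)]
        · exact sum_congr rfl fun v (hv : v ∈ cell H D f w) => by simp [hv]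
        · intro v _ (hv : v ∉ cell H D f w)
          simp [hv]
      · simp [h0]
    rw [e1, hℓ, mul_sum]
    refine sum_le_sum fun v hv => ?_
    rw [mul_comm, ← nsmul_eq_mul, ← sum_const]
    refine (sum_le_sum (fun w hw => ?_)).trans
      (sum_le_sum_of_subset_of_nonneg (subset_univ _) fun _ _ _ => by positivity)
    simp only [mem_filter] at hw
    set N : Finset V := {u ∈ ({u ∈ H | w ∈ D u} : Finset V) | G.Adj v u} with hN
    refine (card_good_ge hK hD hv hw.1 (N := N) fun u hu => ?_).trans ?_
    · simp only [hN, mem_filter] at hu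
      exact hu.1
    · have : ({f : V → Fin K | f w = 0 ∧ v ∈ cell H D f w ∧
          #N ≤ 2 * #{u ∈ N | u ∈ cell H D f w}} : Finset (V → Fin K)) ⊆
          ({f : V → Fin K | f w = 0 ∧ v ∈ cell H D f w ∧
          τ ≤ 2 * degIn G (cell H D f w) v} : Finset (V → Fin K)) := by
        intro f hf
        simp only [mem_filter, mem_univ, true_and] at hf ⊢
        refine ⟨hf.1, hf.2.1, hw.2.trans ?_⟩
        have h1 : #{u ∈ N | u ∈ cell H D f w} ≤ degIn G (cell H D f w) v := by
          refine card_le_card fun u hu => ?_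
          simp only [hN, mem_filter] at hu ⊢
          exact ⟨hu.2, hu.1.2⟩
        have h2 : degIn G {u ∈ H | w ∈ D u} v = #N := rfl
        rw [h2]
        exact_mod_cast hf.2.2.trans (Nat.mul_le_mul_left 2 h1)
      exact_mod_cast card_le_card this
  have hex : ∃ f, 5 / (64 * t) * ℓ ≤ g f := by
    by_contra hcon
    push Not at hcon
    have := sum_lt_sum_of_nonempty (univ_nonempty (α := V → Fin K)) fun f _ => hcon f
    simp only [sum_const, nsmul_eq_mul, card_univ, Fintype.card_pi, Fintype.card_fin,
      prod_const] at this
    have h5 : (K : ℝ) = 8 * t := by exact_mod_cast hK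
    have h6 : (((K ^ Fintype.card V : ℕ) : ℝ)) * (5 / (64 * t) * ℓ) = 5 / 8 * Q * ℓ := by
      have ht0 : (0 : ℝ) < t := by exact_mod_cast ht
      rw [hQ]
      push_cast
      rw [h5]
      field_simp
      ring
    linarith
  obtain ⟨f, hf⟩ := hex
  refine ⟨univ.filter (f · = 0), fun w => cell H D f w, fun w _ v hv => ?_, ?_, hf⟩
  · simp only [cell, mem_filter] at hv ⊢
    exact ⟨hv.1, hv.2.1⟩
  · intro w hw w' hw' hne
    rw [Function.onFun, disjoint_left]
    intro v hv hv'
    simp only [cell, mem_filter] at hv hv'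
    have hw0 : f w' = 0 := by simpa using hw'
    exact hne (hv.2.2 w' hv'.2.1 hw0).symm

end Sampling

section LargeDegrees

open Finset
open scoped Classical

theorem cliqueFreeOn_of_adj {G : SimpleGraph V} {U P : Finset V} {n : ℕ}
    (hU : G.CliqueFreeOn U (n + 2)) {w : V} (hP : ∀ v ∈ P, w ∈ U ∧ v ∈ U ∧ G.Adj w v) :
    G.CliqueFreeOn P (n + 1) := by
  intro K hKP hK
  have hsub : ∀ v ∈ K, w ∈ U ∧ v ∈ U ∧ G.Adj w v := fun v hv => hP v (by simpa using hKP hv)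
  obtain ⟨v, hv⟩ : K.Nonempty := by
    rw [← card_pos, hK.card_eq]
    omega
  refine hU ?_ (hK.insert fun v hv => (hsub v hv).2.2)
  rw [coe_insert, Set.insert_subset_iff]
  exact ⟨(hsub v hv).1, fun x hx => (hsub x hx).2.1⟩

theorem degIn_eq_zero {G : SimpleGraph V} {U : Finset V} (hU : G.CliqueFreeOn U 2) {v : V}
    (hv : v ∈ U) : degIn G U v = 0 := by
  rw [degIn, card_eq_zero, filter_eq_empty_iff]
  exact fun u hu h => (SimpleGraph.cliqueFreeOn_two G).1 hU hv hu h.ne h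

theorem sum_codegree_le {G : SimpleGraph V} {U H : Finset V} {D L : V → Finset V} {τ : ℝ}
    (hLD : ∀ v, L v ⊆ D v) (hDH : ∀ v, v ∉ H → D v = ∅)
    (hL : ∀ v, ∀ a ∈ L v, (degIn G {u ∈ H | a ∈ D u} v : ℝ) ≤ τ) :
    ∑ u ∈ U, ∑ v ∈ U, (if G.Adj u v then (#(L u ∩ L v) : ℝ) else 0)
      ≤ τ * ∑ v ∈ U, (#(L v) : ℝ) := by
  rw [sum_comm, mul_sum]
  refine sum_le_sum fun v _ => ?_
  have e : ∑ u ∈ U, (if G.Adj u v then (#(L u ∩ L v) : ℝ) else 0)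
      = ∑ a ∈ L v, (#{u ∈ U | G.Adj u v ∧ a ∈ L u} : ℝ) := by
    simp only [card_filter, Nat.cast_sum]
    rw [sum_comm]
    refine sum_congr rfl fun u _ => ?_
    by_cases h : G.Adj u v
    · simp only [h, if_true, true_and, inter_comm (L u)]
      rw [← filter_mem_eq_inter, card_filter, Nat.cast_sum]
    · simp [h]
  rw [e, mul_comm, ← nsmul_eq_mul, ← sum_const]
  refine sum_le_sum fun a ha => le_trans ?_ (hL v a ha)
  have : #{u ∈ U | G.Adj u v ∧ a ∈ L u} ≤ degIn G {u ∈ H | a ∈ D u} v := by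
    refine card_le_card fun u hu => ?_
    simp only [mem_filter] at hu ⊢
    have hau := hLD u hu.2.2
    refine ⟨⟨?_, hau⟩, hu.2.1.symm⟩
    by_contra h
    simp [hDH u h] at hau
  exact_mod_cast this

theorem rpow_div_succ_rpow {t : ℝ} (ht : 0 ≤ t) {k : ℕ} (hk : 1 ≤ k) :
    (t ^ ((k : ℝ) / (k + 1))) ^ ((1 : ℝ) / k) = t ^ ((1 : ℝ) / (k + 1)) := by
  have hk0 : (k : ℝ) ≠ 0 := by positivity
  rw [← Real.rpow_mul ht]
  congr 1
  field_simp

theorem le_rpow_div_succ_sq {t : ℝ} (ht : 1 ≤ t) {k : ℕ} (hk : 1 ≤ k) :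
    t ≤ (t ^ ((k : ℝ) / (k + 1))) ^ 2 := by
  have hk0 : (1 : ℝ) ≤ k := by exact_mod_cast hk
  rw [← Real.rpow_natCast, ← Real.rpow_mul (by linarith)]
  nth_rewrite 1 [← Real.rpow_one t]
  refine Real.rpow_le_rpow_of_exponent_le ht ?_
  rw [div_mul_eq_mul_div, le_div_iff₀ (by positivity)]
  push_cast
  linarith

theorem div_rpow_div_succ {t : ℝ} (ht : 0 < t) (k : ℕ) :
    t / t ^ ((k : ℝ) / (k + 1)) = t ^ ((1 : ℝ) / (k + 1)) := by
  nth_rewrite 1 [← Real.rpow_one t]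
  rw [← Real.rpow_sub ht]
  congr 1
  have : (k : ℝ) + 1 ≠ 0 := by positivity
  field_simp
  ring

theorem half_rpow_le {τ : ℝ} (hτ : 0 ≤ τ) {k : ℕ} (hk : 1 ≤ k) :
    τ ^ ((1 : ℝ) / k) / 2 ≤ (⌈τ / 2⌉₊ : ℝ) ^ ((1 : ℝ) / k) := by
  have hk0 : (1 : ℝ) ≤ k := by exact_mod_cast hk
  have h1 : (τ / 2) ^ ((1 : ℝ) / k) ≤ (⌈τ / 2⌉₊ : ℝ) ^ ((1 : ℝ) / k) :=
    Real.rpow_le_rpow (by positivity) (Nat.le_ceil _) (by positivity)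
  refine le_trans ?_ h1
  rw [Real.div_rpow hτ (by norm_num)]
  refine div_le_div_of_nonneg_left (by positivity) (by positivity) ?_
  nth_rewrite 2 [← Real.rpow_one 2]
  refine Real.rpow_le_rpow_of_exponent_le (by norm_num) ?_
  rw [div_le_one (by linarith)]
  exact hk0

variable [Fintype V]

theorem hasSurplus_of_many_light {G : SimpleGraph V} {U H : Finset V} {D L : V → Finset V}
    {t : ℕ} (ht : 1 ≤ t) {k : ℕ} (hk : 1 ≤ k) (hHU : H ⊆ U)
    (hDU : ∀ v, ∀ a ∈ D v, a ∈ U ∧ G.Adj v a) (hDt : ∀ v, #(D v) ≤ t)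
    (hDH : ∀ v, v ∉ H → D v = ∅) (hLD : ∀ v, L v ⊆ D v)
    (hL : ∀ v, ∀ a ∈ L v,
      (degIn G {u ∈ H | a ∈ D u} v : ℝ) ≤ (t : ℝ) ^ ((k : ℝ) / (k + 1)))
    (hmany : (t : ℝ) * #H / 2 ≤ ∑ v ∈ H, (#(L v) : ℝ)) :
    HasSurplus G U (1 / 64 * (t : ℝ) ^ ((1 : ℝ) / (k + 1)) * #H) := by
  have ht1 : (1 : ℝ) ≤ t := by exact_mod_cast ht
  set τ : ℝ := (t : ℝ) ^ ((k : ℝ) / (k + 1)) with hτ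
  have hτ1 : 1 ≤ τ := Real.one_le_rpow ht1 (by positivity)
  have hτ2 : (t : ℝ) ≤ τ ^ 2 := le_rpow_div_succ_sq ht1 hk
  have hst := hasSurplus_of_stars (G := G) (U := U) L (ε := 1 / (2 * τ)) (τ := τ)
    (by positivity) (by rw [div_le_one (by positivity)]; linarith)
    (fun v a ha => (hDU v a (hLD v ha)).1) (fun v a ha => (hDU v a (hLD v ha)).2) (fun v => ?_)
    (sum_codegree_le hLD hDH hL)
  · refine hst.mono ?_
    have h1 : ∑ v ∈ H, (#(L v) : ℝ) ≤ ∑ v ∈ U, (#(L v) : ℝ) :=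
      sum_le_sum_of_subset_of_nonneg hHU fun _ _ _ => by positivity
    have h2 : 3 / 16 * (1 / (2 * τ)) - (1 / (2 * τ)) ^ 2 * τ / 4 = 1 / (32 * τ) := by
      field_simp
      norm_num
    rw [h2, ← div_rpow_div_succ (by linarith), ← hτ]
    calc 1 / 64 * ((t : ℝ) / τ) * #H = 1 / (32 * τ) * (t * #H / 2) := by
          field_simp
          ring
      _ ≤ _ := mul_le_mul_of_nonneg_left (hmany.trans h1) (by positivity)
  · have h1 : (#(L v) : ℝ) ≤ t := by
      exact_mod_cast (card_le_card (hLD v)).trans (hDt v)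
    rw [one_div_pow, one_div_mul_eq_div, div_le_one (by positivity)]
    nlinarith

theorem hasSurplus_of_many_heavy {G : SimpleGraph V} {U H : Finset V} {D : V → Finset V}
    {t : ℕ} (ht : 1 ≤ t) {k : ℕ} (hk : 1 ≤ k) {c : ℝ} (hc : 0 < c)
    (ih : ∀ P : Finset V, G.CliqueFreeOn P (k + 1) → ∀ T : ℕ, 1 ≤ T →
      HasSurplus G P (c * (T : ℝ) ^ ((1 : ℝ) / k) * #{v ∈ P | T ≤ degIn G P v}))
    (hU : G.CliqueFreeOn U (k + 2)) (hHU : H ⊆ U)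
    (hDU : ∀ v, ∀ a ∈ D v, a ∈ U ∧ G.Adj v a) (hDt : ∀ v, #(D v) ≤ t)
    (hmany : (t : ℝ) * #H / 2 ≤ ∑ v ∈ H,
      (#{w ∈ D v | (t : ℝ) ^ ((k : ℝ) / (k + 1)) ≤ degIn G {u ∈ H | w ∈ D u} v} : ℝ)) :
    HasSurplus G U (c / 64 * (t : ℝ) ^ ((1 : ℝ) / (k + 1)) * #H) := by
  have ht1 : (1 : ℝ) ≤ t := by exact_mod_cast ht
  set τ : ℝ := (t : ℝ) ^ ((k : ℝ) / (k + 1)) with hτ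
  have hτ1 : 1 ≤ τ := Real.one_le_rpow ht1 (by positivity)
  obtain ⟨W, C, hCsub, hCdisj, hCsum⟩ := exists_cells (G := G) H D ht hDt τ
  set T : ℕ := ⌈τ / 2⌉₊ with hT
  have hT1 : 1 ≤ T := Nat.one_le_iff_ne_zero.2 (Nat.ceil_pos.2 (by positivity)).ne'
  have hcells := hasSurplus_biUnion W C _ hCdisj fun w hw => ih (C w)
    (cliqueFreeOn_of_adj hU (w := w) fun v hv => by
      have := hCsub w hw hv
      simp only [mem_filter] at this
      exact ⟨(hDU v w this.2).1, hHU this.1, (hDU v w this.2).2.symm⟩) T hT1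
  refine (hcells.subset (W := U) ?_).mono ?_
  · refine biUnion_subset.2 fun w hw => (hCsub w hw).trans ((filter_subset _ _).trans hHU)
  · rw [← mul_sum]
    have e : ∀ w, (#{v ∈ C w | T ≤ degIn G (C w) v} : ℝ)
        = #{v ∈ C w | τ ≤ 2 * degIn G (C w) v} := by
      intro w
      congr 2
      refine filter_congr fun v _ => ?_
      rw [hT, Nat.ceil_le]
      constructor <;> intro h <;> linarith
    simp only [e]
    have h1 : τ ^ ((1 : ℝ) / k) / 2 ≤ (T : ℝ) ^ ((1 : ℝ) / k) := half_rpow_le (by linarith) hk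
    rw [hτ, rpow_div_succ_rpow (by linarith) hk] at h1
    set p : ℝ := (t : ℝ) ^ ((1 : ℝ) / (k + 1)) with hp
    have hp0 : 0 ≤ p := by positivity
    have h2 : 5 / 128 * (#H : ℝ) ≤ ∑ w ∈ W, (#{v ∈ C w | τ ≤ 2 * degIn G (C w) v} : ℝ) := by
      refine le_trans ?_ hCsum
      calc 5 / 128 * (#H : ℝ) = 5 / (64 * t) * (t * #H / 2) := by
            field_simp
            ring
        _ ≤ _ := mul_le_mul_of_nonneg_left hmany (by positivity)
    have h3 : c * (p / 2) * (5 / 128 * #H) ≤ c * (T : ℝ) ^ ((1 : ℝ) / k) *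
        ∑ w ∈ W, (#{v ∈ C w | τ ≤ 2 * degIn G (C w) v} : ℝ) :=
      mul_le_mul (mul_le_mul_of_nonneg_left h1 hc.le) h2 (by positivity) (by positivity)
    refine le_trans ?_ h3
    have : 0 ≤ c * p * #H := by positivity
    linarith

theorem exists_const_hasSurplus_degree {k : ℕ} (hk : 1 ≤ k) :
    ∃ c : ℝ, 0 < c ∧ ∀ (V : Type) [Fintype V] (G : SimpleGraph V) (U : Finset V),
      G.CliqueFreeOn U (k + 1) → ∀ t : ℕ, 1 ≤ t →
        HasSurplus G U (c * (t : ℝ) ^ ((1 : ℝ) / k) * #{v ∈ U | t ≤ degIn G U v}) := by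
  induction k, hk using Nat.le_induction with
  | base =>
    refine ⟨1, one_pos, fun V _ G U hU t ht => ?_⟩
    have : ({v ∈ U | t ≤ degIn G U v} : Finset V) = ∅ := by
      rw [filter_eq_empty_iff]
      intro v hv hd
      have := degIn_eq_zero hU hv
      omega
    rw [this]
    simpa using hasSurplus_zero G U
  | succ k hk ih =>
    obtain ⟨c, hc, ih⟩ := ih
    refine ⟨min (c / 64) (1 / 64), by positivity, fun V _ G U hU t ht => ?_⟩
    set H : Finset V := {v ∈ U | t ≤ degIn G U v} with hH
    have hex : ∀ v, ∃ S : Finset V, (∀ a ∈ S, a ∈ U ∧ G.Adj v a) ∧ #S ≤ t ∧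
        (v ∈ H → #S = t) ∧ (v ∉ H → S = ∅) := by
      intro v
      by_cases hv : v ∈ H
      · obtain ⟨S, hS, hSt⟩ := exists_subset_card_eq (mem_filter.1 hv).2
        exact ⟨S, fun a ha => by simpa using hS ha, hSt.le, fun _ => hSt, fun h => absurd hv h⟩
      · exact ⟨∅, by simp, by simp, fun h => absurd h hv, fun _ => rfl⟩
    choose D hDU hDt hDeq hDH using hex
    have hHU : H ⊆ U := filter_subset _ _
    have htot : ∑ v ∈ H,
        (#{w ∈ D v | (t : ℝ) ^ ((k : ℝ) / (k + 1)) ≤ degIn G {u ∈ H | w ∈ D u} v} : ℝ)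
        + ∑ v ∈ H,
        (#{w ∈ D v | ¬ (t : ℝ) ^ ((k : ℝ) / (k + 1)) ≤ degIn G {u ∈ H | w ∈ D u} v} : ℝ)
        = t * #H := by
      rw [← sum_add_distrib, mul_comm, ← nsmul_eq_mul, ← sum_const]
      refine sum_congr rfl fun v hv => ?_
      rw [← hDeq v hv]
      exact_mod_cast card_filter_add_card_filter_not _
    push_cast
    have hfac : 0 ≤ (t : ℝ) ^ ((1 : ℝ) / (k + 1)) * #H := by positivity
    by_cases hheavy : (t : ℝ) * #H / 2 ≤ ∑ v ∈ H,
        (#{w ∈ D v | (t : ℝ) ^ ((k : ℝ) / (k + 1)) ≤ degIn G {u ∈ H | w ∈ D u} v} : ℝ)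
    · refine (hasSurplus_of_many_heavy ht hk hc (ih V G) hU hHU hDU hDt hheavy).mono ?_
      rw [mul_assoc, mul_assoc]
      exact mul_le_mul_of_nonneg_right (min_le_left _ _) hfac
    · refine (hasSurplus_of_many_light (L := fun v =>
        {w ∈ D v | ¬ (t : ℝ) ^ ((k : ℝ) / (k + 1)) ≤ degIn G {u ∈ H | w ∈ D u} v})
        ht hk hHU hDU hDt hDH (fun v => filter_subset _ _) (fun v a ha => ?_) ?_).mono ?_
      · exact (not_le.1 (mem_filter.1 ha).2).le
      · linarith
      · rw [mul_assoc, mul_assoc]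
        exact mul_le_mul_of_nonneg_right (min_le_right _ _) hfac

end LargeDegrees

section Dense

open Finset
open scoped Classical

theorem exists_sparse_subset {G : SimpleGraph V} {κ : ℝ} (hκ : 0 ≤ κ) (hκ1 : κ ≤ 1) (k : ℕ)
    {R : Finset V} (hR : G.CliqueFreeOn R (k + 2)) :
    ∃ U ⊆ R, κ ^ k * #R ≤ #U ∧ ∑ v ∈ U, (degIn G U v : ℝ) ≤ κ * (#U : ℝ) ^ 2 := by
  induction k generalizing R with
  | zero =>
    refine ⟨R, Subset.rfl, by simp, ?_⟩
    rw [sum_eq_zero fun v hv => by rw [degIn_eq_zero hR hv, Nat.cast_zero]]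
    positivity
  | succ k ih =>
    by_cases hs : ∑ v ∈ R, (degIn G R v : ℝ) ≤ κ * (#R : ℝ) ^ 2
    · refine ⟨R, Subset.rfl, ?_, hs⟩
      have : κ ^ (k + 1) ≤ 1 := pow_le_one₀ hκ hκ1
      nlinarith [(Nat.cast_nonneg #R : (0 : ℝ) ≤ #R)]
    · have hex : ∃ v ∈ R, κ * #R < degIn G R v := by
        by_contra hcon
        push Not at hcon
        refine hs ((sum_le_sum hcon).trans ?_)
        rw [sum_const, nsmul_eq_mul]
        exact le_of_eq (by ring)
      obtain ⟨v, hv, hvd⟩ := hex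
      obtain ⟨U, hUR, hUc, hUs⟩ := ih (R := {u ∈ R | G.Adj v u})
        (cliqueFreeOn_of_adj hR (w := v) fun u hu => ⟨hv, mem_filter.1 hu⟩)
      refine ⟨U, hUR.trans (filter_subset _ _), le_trans ?_ hUc, hUs⟩
      rw [pow_succ, mul_assoc]
      exact mul_le_mul_of_nonneg_left hvd.le (by positivity)

theorem exists_sparse_family [Fintype V] {G : SimpleGraph V} {κ : ℝ} (hκ : 0 < κ) (hκ1 : κ ≤ 1)
    {k : ℕ} {B : Finset V} (hB : G.CliqueFreeOn B (k + 2)) (hne : B.Nonempty) :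
    ∃ F : Finset (Finset V), (F : Set (Finset V)).PairwiseDisjoint id ∧
      (∀ U ∈ F, U ⊆ B ∧ κ ^ k * (#B / 2) ≤ #U ∧
        ∑ v ∈ U, (degIn G U v : ℝ) ≤ κ * (#U : ℝ) ^ 2) ∧
      (#B : ℝ) / 2 ≤ ∑ U ∈ F, (#U : ℝ) := by
  set valid : Finset (Finset (Finset V)) := {F | (F : Set (Finset V)).PairwiseDisjoint id ∧
      (∀ U ∈ F, U ⊆ B ∧ κ ^ k * (#B / 2) ≤ #U ∧
        ∑ v ∈ U, (degIn G U v : ℝ) ≤ κ * (#U : ℝ) ^ 2)} with hvalid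
  obtain ⟨F, hF, hmax⟩ := exists_max_image valid card ⟨∅, by simp [hvalid]⟩
  have hF' := hF
  simp only [hvalid, mem_filter, mem_univ, true_and] at hF
  refine ⟨F, hF.1, hF.2, ?_⟩
  by_contra hlt
  push Not at hlt
  have hcard : (#(F.biUnion id) : ℝ) = ∑ U ∈ F, (#U : ℝ) := by
    rw [card_biUnion hF.1]
    simp
  have hsub : F.biUnion id ⊆ B := biUnion_subset.2 fun U hU => (hF.2 U hU).1
  have hRc : (#B : ℝ) / 2 ≤ #(B \ F.biUnion id) := by
    rw [cast_card_sdiff hsub, hcard]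
    linarith
  obtain ⟨U, hUR, hUc, hUs⟩ := exists_sparse_subset hκ.le hκ1 k (R := B \ F.biUnion id)
    (hB.subset G (coe_subset.2 sdiff_subset))
  have hU1 : κ ^ k * (#B / 2) ≤ #U :=
    (mul_le_mul_of_nonneg_left hRc (by positivity)).trans hUc
  have hBpos : (0 : ℝ) < #B := by exact_mod_cast hne.card_pos
  have hUpos : (0 : ℝ) < #U := lt_of_lt_of_le (by positivity) hU1
  have hUne : U.Nonempty := card_pos.1 (by exact_mod_cast hUpos)
  have hdisj : ∀ W ∈ F, Disjoint U W := fun W hW =>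
    disjoint_of_subset_left hUR (disjoint_sdiff_self_left.mono_right
      (subset_biUnion_of_mem id hW))
  have hUF : U ∉ F := fun h => by
    have := hdisj U h
    rw [disjoint_self_iff_empty] at this
    exact hUne.ne_empty this
  have := hmax (insert U F) (by
    simp only [hvalid, mem_filter, mem_univ, true_and]
    refine ⟨?_, ?_⟩
    · rw [coe_insert]
      exact hF.1.insert fun W hW _ => hdisj W hW
    · intro W hW
      rcases mem_insert.1 hW with rfl | hW
      · exact ⟨hUR.trans sdiff_subset, hU1, hUs⟩
      · exact hF.2 W hW)
  rw [card_insert_of_notMem hUF] at this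
  omega

theorem sum_adj_mem {G : SimpleGraph V} {U B : Finset V} (hUB : U ⊆ B) (u : V) :
    ∑ v ∈ B, (if G.Adj u v then (if v ∈ U then (1 : ℝ) else 0) else 0) = degIn G U u := by
  rw [degIn, card_filter, Nat.cast_sum, ← sum_subset hUB]
  · exact sum_congr rfl fun v hv => by simp [hv]
  · intro v _ hv
    simp [hv]

theorem quad_indicator_sub_const (G : SimpleGraph V) {U B : Finset V} (hUB : U ⊆ B) (p q : ℝ) :
    quad G B (fun v => p * (if v ∈ U then 1 else 0) - q)
      = p ^ 2 * ∑ v ∈ U, (degIn G U v : ℝ) - 2 * p * q * ∑ v ∈ U, (degIn G B v : ℝ)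
        + q ^ 2 * ∑ v ∈ B, (degIn G B v : ℝ) := by
  have e1 : ∀ W ⊆ B, ∑ u ∈ B, ∑ v ∈ B, (if G.Adj u v then
      (if u ∈ U then (1 : ℝ) else 0) * (if v ∈ W then (1 : ℝ) else 0) else 0)
      = ∑ u ∈ U, (degIn G W u : ℝ) := by
    intro W hW
    rw [← sum_subset hUB]
    · refine sum_congr rfl fun u hu => ?_
      simp only [hu, if_true, one_mul]
      exact sum_adj_mem hW u
    · intro u _ hu
      simp [hu]
  have e2 : ∑ u ∈ B, ∑ v ∈ B, (if G.Adj u v then (if u ∈ U then (1 : ℝ) else 0) else 0)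
      = ∑ u ∈ U, (degIn G B u : ℝ) := by
    rw [← e1 B Subset.rfl]
    exact sum_congr rfl fun u _ => sum_congr rfl fun v hv => by simp [hv]
  have e3 : ∑ u ∈ B, ∑ v ∈ B, (if G.Adj u v then (if v ∈ U then (1 : ℝ) else 0) else 0)
      = ∑ u ∈ U, (degIn G B u : ℝ) := by
    rw [← e2, sum_comm]
    exact sum_congr rfl fun u _ => sum_congr rfl fun v _ => by rw [G.adj_comm]
  have e4 : ∑ u ∈ B, ∑ v ∈ B, (if G.Adj u v then (1 : ℝ) else 0)
      = ∑ u ∈ B, (degIn G B u : ℝ) := by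
    refine sum_congr rfl fun u _ => ?_
    rw [← sum_adj_mem Subset.rfl u]
    exact sum_congr rfl fun v hv => by simp [hv]
  calc quad G B (fun v => p * (if v ∈ U then 1 else 0) - q)
      = p ^ 2 * (∑ u ∈ B, ∑ v ∈ B, (if G.Adj u v then
          (if u ∈ U then (1 : ℝ) else 0) * (if v ∈ U then (1 : ℝ) else 0) else 0))
        - p * q * (∑ u ∈ B, ∑ v ∈ B, (if G.Adj u v then (if u ∈ U then (1 : ℝ) else 0) else 0))
        - p * q * (∑ u ∈ B, ∑ v ∈ B, (if G.Adj u v then (if v ∈ U then (1 : ℝ) else 0) else 0))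
        + q ^ 2 * (∑ u ∈ B, ∑ v ∈ B, (if G.Adj u v then (1 : ℝ) else 0)) := by
        simp only [quad, mul_sum, ← sum_add_distrib, ← sum_sub_distrib]
        refine sum_congr rfl fun u _ => sum_congr rfl fun v _ => ?_
        split_ifs <;> ring
    _ = _ := by
        rw [e1 U hUB, e2, e3, e4]
        ring

theorem quad_block_le {d n N l m a s b : ℝ} (hd : 0 < d) (hN : 0 < N) (hNn : N ≤ n)
    (hnN : n ≤ 2 * N) (hl : 0 ≤ l) (hm : m ≤ l) (ha : a ≤ d / (16 * n) * l ^ 2)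
    (hs : d * l ≤ s) (hb : b ≤ 2 * d * n) :
    (1 / 2) ^ 2 * a - 2 * (1 / 2) * (l / (16 * N)) * s + (l / (16 * N)) ^ 2 * b
      ≤ -(d / (32 * N) * m) * l := by
  have hn : 0 < n := hN.trans_le hNn
  set q : ℝ := d * l ^ 2 / (64 * N) with hq
  have h1 : (1 / 2 : ℝ) ^ 2 * a ≤ q := by
    calc (1 / 2 : ℝ) ^ 2 * a ≤ (1 / 2) ^ 2 * (d / (16 * n) * l ^ 2) :=
          mul_le_mul_of_nonneg_left ha (by positivity)
      _ = d * l ^ 2 / (64 * n) := by field_simp; ring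
      _ ≤ q := by rw [hq]; gcongr
  have h2 : 4 * q ≤ 2 * (1 / 2) * (l / (16 * N)) * s := by
    calc 4 * q = 2 * (1 / 2) * (l / (16 * N)) * (d * l) := by
          rw [hq]; field_simp; ring
      _ ≤ _ := mul_le_mul_of_nonneg_left hs (by positivity)
  have h3 : (l / (16 * N)) ^ 2 * b ≤ q := by
    calc (l / (16 * N)) ^ 2 * b ≤ (l / (16 * N)) ^ 2 * (2 * d * (2 * N)) := by
          refine mul_le_mul_of_nonneg_left (hb.trans ?_) (by positivity)
          exact mul_le_mul_of_nonneg_left hnN (by positivity)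
      _ = q := by rw [hq]; field_simp; ring
  have h4 : d / (32 * N) * m * l ≤ 2 * q := by
    calc d / (32 * N) * m * l ≤ d / (32 * N) * l * l := by gcongr
      _ = 2 * q := by rw [hq]; ring
  linarith

theorem hasSurplus_of_min_degree [Fintype V] {G : SimpleGraph V} {k : ℕ} {B : Finset V}
    (hB : G.CliqueFreeOn B (k + 2)) (hne : B.Nonempty) {d : ℝ} (hd : 0 < d)
    (hmin : ∀ v ∈ B, d ≤ degIn G B v) (hsum : ∑ v ∈ B, (degIn G B v : ℝ) ≤ 2 * d * #B) :
    HasSurplus G B (d / 64 * (d / (16 * #B)) ^ k * #B) := by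
  have hn : (0 : ℝ) < #B := by exact_mod_cast hne.card_pos
  set n : ℝ := (#B : ℝ)
  have hdn : d ≤ n := by
    obtain ⟨v, hv⟩ := hne
    exact (hmin v hv).trans (Nat.cast_le.2 (card_le_card (filter_subset _ _)))
  obtain ⟨F, hdisj, hF, hcover⟩ := exists_sparse_family (κ := d / (16 * n)) (by positivity)
    (by rw [div_le_one (by positivity)]; linarith) hB hne
  set N : ℝ := ∑ U ∈ F, (#U : ℝ) with hN
  have hcover' : n ≤ 2 * N := by linarith
  have hNpos : 0 < N := by linarith
  have hNn : N ≤ n := by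
    have h1 : (#(F.biUnion id) : ℝ) = N := by
      rw [card_biUnion hdisj]
      simp [hN]
    rw [← h1]
    exact Nat.cast_le.2 (card_le_card (biUnion_subset.2 fun U hU => (hF U hU).1))
  obtain ⟨z, hz, hq⟩ := exists_signed_sum G B F
    (fun U v => 1 / 2 * (if v ∈ U then 1 else 0) - #U / (16 * N))
  refine ⟨z, fun v => (hz v).trans ?_, hq.trans ?_⟩
  · have h1 : ∑ U ∈ F, (if v ∈ U then (1 : ℝ) else 0) ≤ 1 := by
      rw [sum_boole]
      have : #{U ∈ F | v ∈ U} ≤ 1 := by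
        rw [card_le_one]
        intro U hU W hW
        simp only [mem_filter] at hU hW
        by_contra hne
        exact disjoint_left.1 (hdisj hU.1 hW.1 hne) hU.2 hW.2
      exact_mod_cast this
    have h2 : ∑ U ∈ F, (#U : ℝ) / (16 * N) = 1 / 16 := by
      rw [← sum_div, ← hN]
      field_simp
    calc ∑ U ∈ F, |1 / 2 * (if v ∈ U then (1 : ℝ) else 0) - #U / (16 * N)|
        ≤ ∑ U ∈ F, (1 / 2 * (if v ∈ U then (1 : ℝ) else 0) + #U / (16 * N)) := by
          refine sum_le_sum fun U _ => (abs_sub_le_add_abs _ _).trans (le_of_eq ?_)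
          have e1 : (0 : ℝ) ≤ 1 / 2 * (if v ∈ U then (1 : ℝ) else 0) := by split_ifs <;> norm_num
          have e2 : (0 : ℝ) ≤ #U / (16 * N) :=
            div_nonneg (Nat.cast_nonneg _) (by linarith)
          rw [abs_of_nonneg e1, abs_of_nonneg e2]
      _ ≤ 1 := by
          rw [sum_add_distrib, ← mul_sum, h2]
          linarith
  · set m₀ : ℝ := (d / (16 * n)) ^ k * (n / 2) with hm₀
    have hterm : ∀ U ∈ F, quad G B
        (fun v => 1 / 2 * (if v ∈ U then 1 else 0) - #U / (16 * N))
        ≤ -(d / (32 * N) * m₀) * #U := by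
      intro U hU
      obtain ⟨hUB, hUc, hUs⟩ := hF U hU
      rw [quad_indicator_sub_const G hUB]
      refine quad_block_le hd hNpos hNn hcover' (by positivity) hUc hUs ?_ hsum
      rw [mul_comm, ← nsmul_eq_mul, ← sum_const]
      exact sum_le_sum fun v hv => hmin v (hUB hv)
    refine (sum_le_sum hterm).trans (le_of_eq ?_)
    rw [← mul_sum, ← hN, hm₀]
    field_simp
    norm_num

theorem sum_degIn_erase {G : SimpleGraph V} {B : Finset V} {v : V} (hv : v ∈ B) :
    ∑ u ∈ B.erase v, (degIn G (B.erase v) u : ℝ)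
      = ∑ u ∈ B, (degIn G B u : ℝ) - 2 * degIn G B v := by
  have h1 : ∀ u, (degIn G B u : ℝ) = degIn G (B.erase v) u + if G.Adj u v then 1 else 0 := by
    intro u
    simp only [degIn, card_filter, Nat.cast_sum]
    rw [← add_sum_erase B _ hv, add_comm]
    simp
  have h2 : (degIn G B v : ℝ) = ∑ u ∈ B.erase v, if G.Adj u v then (1 : ℝ) else 0 := by
    rw [h1 v]
    simp only [degIn, card_filter, Nat.cast_sum, SimpleGraph.irrefl, if_false, add_zero]
    refine sum_congr rfl fun u _ => ?_
    rw [G.adj_comm]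
    simp
  have h3 : ∑ u ∈ B.erase v, (degIn G (B.erase v) u : ℝ) + degIn G B v
      = ∑ u ∈ B.erase v, (degIn G B u : ℝ) := by
    rw [h2, ← sum_add_distrib]
    exact sum_congr rfl fun u _ => (h1 u).symm
  rw [← add_sum_erase B _ hv]
  linarith

theorem exists_min_degree_ge [Fintype V] {G : SimpleGraph V} {A : Finset V} (hA : A.Nonempty)
    {d : ℝ} (hdens : 2 * d * #A ≤ ∑ v ∈ A, (degIn G A v : ℝ)) :
    ∃ (B : Finset V) (d' : ℝ), B.Nonempty ∧ d ≤ d' ∧ (∀ v ∈ B, d' ≤ degIn G B v) ∧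
      ∑ v ∈ B, (degIn G B v : ℝ) = 2 * d' * #B := by
  obtain ⟨B, hB, hmax⟩ := exists_max_image ({S | S.Nonempty} : Finset (Finset V))
    (fun S => (∑ v ∈ S, (degIn G S v : ℝ)) / #S) ⟨A, by simpa using hA⟩
  have hBne : B.Nonempty := by simpa using hB
  have hn : (0 : ℝ) < #B := by exact_mod_cast hBne.card_pos
  set d' : ℝ := (∑ v ∈ B, (degIn G B v : ℝ)) / #B / 2 with hd'
  have heq : ∑ v ∈ B, (degIn G B v : ℝ) = 2 * d' * #B := by
    rw [hd']
    field_simp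
  have hge : ∀ S : Finset V, S.Nonempty → ∑ v ∈ S, (degIn G S v : ℝ) ≤ 2 * d' * #S := by
    intro S hS
    have h1 := hmax S (by simpa using hS)
    have h2 : (0 : ℝ) < #S := by exact_mod_cast hS.card_pos
    rw [div_le_iff₀ h2] at h1
    refine h1.trans (le_of_eq ?_)
    rw [hd']
    ring
  have hdd : d ≤ d' := by
    have h1 := hdens.trans (hge A hA)
    have h2 : (0 : ℝ) < #A := by exact_mod_cast hA.card_pos
    have := le_of_mul_le_mul_right h1 h2
    linarith
  refine ⟨B, d', hBne, hdd, fun v hv => ?_, heq⟩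
  have herase := sum_degIn_erase (G := G) hv
  have hcard : (#(B.erase v) : ℝ) = #B - 1 := by
    rw [card_erase_of_mem hv, Nat.cast_sub hBne.card_pos, Nat.cast_one]
  have hle : ∑ u ∈ B.erase v, (degIn G (B.erase v) u : ℝ) ≤ 2 * d' * #(B.erase v) := by
    rcases (B.erase v).eq_empty_or_nonempty with h | h
    · simp [h]
    · exact hge _ h
  rw [herase, hcard, heq] at hle
  linarith

end Dense

section Combine

open Finset
open scoped Classical

theorem sum_Icc_inv_sqrt_le (T : ℕ) : ∑ t ∈ Icc 1 T, (√(t : ℝ))⁻¹ ≤ 2 * √T := by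
  induction T with
  | zero => simp
  | succ T ih =>
    rw [sum_Icc_succ_top (by omega)]
    refine (add_le_add_left ih _).trans ?_
    have h1 : 0 < √((T + 1 : ℕ) : ℝ) := Real.sqrt_pos.2 (by positivity)
    have h2 : √((T + 1 : ℕ) : ℝ) ^ 2 = T + 1 := by
      rw [Real.sq_sqrt (by positivity)]
      push_cast
      ring
    have h3 : √(T : ℝ) ^ 2 = T := Real.sq_sqrt (by positivity)
    have h4 : √((T + 1 : ℕ) : ℝ) * (√((T + 1 : ℕ) : ℝ))⁻¹ = 1 := mul_inv_cancel₀ h1.ne'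
    refine le_of_mul_le_mul_left ?_ h1
    nlinarith [sq_nonneg (√((T + 1 : ℕ) : ℝ) - √(T : ℝ))]

theorem sum_Icc_rpow_neg_le {α : ℝ} (hα : α ≤ 1 / 2) (T : ℕ) :
    ∑ t ∈ Icc 1 T, (t : ℝ) ^ (-α) ≤ 2 * (T : ℝ) ^ (1 - α) := by
  rcases Nat.eq_zero_or_pos T with rfl | hT
  · simpa using by positivity
  have hT' : (0 : ℝ) < T := by exact_mod_cast hT
  calc ∑ t ∈ Icc 1 T, (t : ℝ) ^ (-α)
      ≤ ∑ t ∈ Icc 1 T, (T : ℝ) ^ (1 / 2 - α) * (√(t : ℝ))⁻¹ := by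
        refine sum_le_sum fun t ht => ?_
        rw [mem_Icc] at ht
        have ht0 : (0 : ℝ) < t := by exact_mod_cast ht.1
        rw [Real.sqrt_eq_rpow, ← Real.rpow_neg ht0.le]
        calc (t : ℝ) ^ (-α) = (t : ℝ) ^ (1 / 2 - α) * (t : ℝ) ^ (-(1 / 2) : ℝ) := by
              rw [← Real.rpow_add ht0]
              congr 1
              ring
          _ ≤ _ := mul_le_mul_of_nonneg_right (Real.rpow_le_rpow ht0.le
              (by exact_mod_cast ht.2) (by linarith)) (by positivity)
    _ ≤ (T : ℝ) ^ (1 / 2 - α) * (2 * √T) := by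
        rw [← mul_sum]
        exact mul_le_mul_of_nonneg_left (sum_Icc_inv_sqrt_le T) (by positivity)
    _ = 2 * (T : ℝ) ^ (1 - α) := by
        rw [Real.sqrt_eq_rpow, mul_left_comm, ← Real.rpow_add hT']
        congr 2
        ring

theorem sum_degIn_comm (G : SimpleGraph V) (A B : Finset V) :
    ∑ v ∈ A, (degIn G B v : ℝ) = ∑ v ∈ B, (degIn G A v : ℝ) := by
  simp only [degIn, card_filter, Nat.cast_sum]
  rw [sum_comm]
  exact sum_congr rfl fun u _ => sum_congr rfl fun v _ => by rw [G.adj_comm]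

variable [Fintype V]

theorem sum_min_degIn_eq (G : SimpleGraph V) (T : ℕ) :
    ∑ v, min (degIn G univ v) T = ∑ t ∈ Icc 1 T, #{v ∈ univ | t ≤ degIn G univ v} := by
  simp only [card_filter]
  rw [sum_comm]
  refine sum_congr rfl fun v _ => ?_
  rw [← card_filter]
  have : {t ∈ Icc 1 T | t ≤ degIn G univ v} = Icc 1 (min (degIn G univ v) T) := by
    ext t
    simp only [mem_filter, mem_Icc, le_min_iff]
    tauto
  rw [this, Nat.card_Icc]
  omega

theorem degIn_add_degIn_compl (G : SimpleGraph V) (A : Finset V) (v : V) :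
    (degIn G A v : ℝ) + degIn G Aᶜ v = degIn G univ v := by
  simp only [degIn, card_filter, Nat.cast_sum]
  exact sum_add_sum_compl A _

theorem two_mul_edgeCount_le (G : SimpleGraph V) (A : Finset V) :
    2 * (edgeCount G : ℝ)
      ≤ ∑ v ∈ A, (degIn G A v : ℝ) + 2 * ∑ v ∈ Aᶜ, (degIn G univ v : ℝ) := by
  have h1 : ∑ v ∈ A, (degIn G Aᶜ v : ℝ) ≤ ∑ v ∈ Aᶜ, (degIn G univ v : ℝ) := by
    rw [sum_degIn_comm]
    refine sum_le_sum fun v _ => Nat.cast_le.2 (card_le_card ?_)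
    exact filter_subset_filter _ (subset_univ _)
  have h2 : ∑ v ∈ A, (degIn G univ v : ℝ)
      = ∑ v ∈ A, (degIn G A v : ℝ) + ∑ v ∈ A, (degIn G Aᶜ v : ℝ) := by
    rw [← sum_add_distrib]
    exact sum_congr rfl fun v _ => (degIn_add_degIn_compl G A v).symm
  rw [← sum_degIn_univ, ← sum_add_sum_compl A]
  linarith

theorem edgeCount_le_of_sparse {G : SimpleGraph V} {d : ℝ} {T : ℕ} (hdT : d ≤ T)
    (hsparse : ∑ v ∈ ({v | T ≤ degIn G univ v} : Finset V),
      (degIn G ({v | T ≤ degIn G univ v} : Finset V) v : ℝ)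
        ≤ 2 * d * #({v | T ≤ degIn G univ v} : Finset V)) :
    (edgeCount G : ℝ) ≤ ∑ t ∈ Icc 1 T, (#{v ∈ univ | t ≤ degIn G univ v} : ℝ) := by
  set A : Finset V := {v | T ≤ degIn G univ v} with hA
  have h1 := two_mul_edgeCount_le G A
  have h2 : ∑ v ∈ A, ((min (degIn G univ v) T : ℕ) : ℝ) = T * #A := by
    rw [mul_comm, ← nsmul_eq_mul, ← sum_const]
    refine sum_congr rfl fun v hv => ?_
    simp only [hA, mem_filter, mem_univ, true_and] at hv
    rw [min_eq_right hv]
  have h3 : ∑ v ∈ Aᶜ, ((min (degIn G univ v) T : ℕ) : ℝ) = ∑ v ∈ Aᶜ, (degIn G univ v : ℝ) := by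
    refine sum_congr rfl fun v hv => ?_
    simp only [hA, mem_compl, mem_filter, mem_univ, true_and, not_le] at hv
    rw [min_eq_left hv.le]
  have h4 : ∑ t ∈ Icc 1 T, (#{v ∈ univ | t ≤ degIn G univ v} : ℝ)
      = ∑ v, ((min (degIn G univ v) T : ℕ) : ℝ) := by
    exact_mod_cast (sum_min_degIn_eq G T).symm
  rw [h4, ← sum_add_sum_compl A, h2, h3]
  nlinarith [mul_le_mul_of_nonneg_right hdT (Nat.cast_nonneg #A : (0 : ℝ) ≤ #A)]

theorem sum_degIn_le (G : SimpleGraph V) (B : Finset V) :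
    ∑ v ∈ B, (degIn G B v : ℝ) ≤ 2 * edgeCount G := by
  rw [← sum_degIn_univ]
  refine (sum_le_sum_of_subset_of_nonneg (subset_univ B) fun _ _ _ => by positivity).trans
    (sum_le_sum fun v _ => Nat.cast_le.2 (card_le_card ?_))
  exact filter_subset_filter _ (subset_univ _)

theorem pow_div_le_of_mul_le {d e n m : ℝ} (hd : 0 < d) (hde : d ≤ e) (hn : 0 < n)
    (hen : e * n ≤ m) {k : ℕ} (hk : 1 ≤ k) :
    d ^ (2 * k) / m ^ (k - 1) ≤ e * (e / n) ^ k * n := by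
  obtain ⟨j, rfl⟩ := Nat.exists_eq_add_of_le' hk
  have he : 0 < e := hd.trans_le hde
  calc d ^ (2 * (j + 1)) / m ^ (j + 1 - 1) ≤ e ^ (2 * (j + 1)) / (e * n) ^ j := by
        rw [Nat.add_sub_cancel]
        gcongr
    _ = e * (e / n) ^ (j + 1) * n := by
        rw [mul_pow, div_pow, pow_succ n]
        field_simp
        ring

theorem le_surplus_of_dense {G : SimpleGraph V} {k : ℕ} (hk : 1 ≤ k) (hG : G.CliqueFree (k + 2))
    {A : Finset V} (hA : A.Nonempty) {d : ℝ} (hd : 0 < d)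
    (hdens : 2 * d * #A ≤ ∑ v ∈ A, (degIn G A v : ℝ)) :
    1 / 256 * (1 / 16) ^ k * (d ^ (2 * k) / (edgeCount G : ℝ) ^ (k - 1)) ≤ surplus G := by
  obtain ⟨B, e, hB, hde, hmin, hsum⟩ := exists_min_degree_ge hA hdens
  have hn : (0 : ℝ) < #B := by exact_mod_cast hB.card_pos
  have h1 := ((hasSurplus_of_min_degree (hG.cliqueFreeOn (s := B)) hB (hd.trans_le hde) hmin
    hsum.le).subset (subset_univ B)).le_surplus
  have h2 := sum_degIn_le G B
  rw [hsum] at h2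
  refine le_trans ?_ h1
  calc 1 / 256 * (1 / 16) ^ k * (d ^ (2 * k) / (edgeCount G : ℝ) ^ (k - 1))
      ≤ 1 / 256 * (1 / 16) ^ k * (e * (e / #B) ^ k * #B) :=
        mul_le_mul_of_nonneg_left (pow_div_le_of_mul_le hd hde hn (by linarith) hk)
          (by positivity)
    _ = _ := by
        rw [mul_comm (16 : ℝ), ← div_div, div_eq_mul_one_div (e / #B) 16, mul_pow]
        ring

theorem le_surplus_of_level_sets {G : SimpleGraph V} {c α : ℝ} (hc : 0 < c) (hα : α ≤ 1 / 2)
    {T : ℕ} (hT : 1 ≤ T)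
    (hG : ∀ t : ℕ, 1 ≤ t → HasSurplus G univ (c * (t : ℝ) ^ α * #{v ∈ univ | t ≤ degIn G univ v}))
    (hm : (edgeCount G : ℝ) ≤ ∑ t ∈ Icc 1 T, (#{v ∈ univ | t ≤ degIn G univ v} : ℝ)) :
    c / 8 * (edgeCount G / (T : ℝ) ^ (1 - α)) ≤ surplus G := by
  have hT0 : (0 : ℝ) < T := by exact_mod_cast hT
  have hs : 0 ≤ surplus G := by simpa using (hasSurplus_zero G univ).le_surplus
  have hlevel : ∀ t ∈ Icc 1 T,
      (#{v ∈ univ | t ≤ degIn G univ v} : ℝ) ≤ 4 * surplus G / c * (t : ℝ) ^ (-α) := by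
    intro t ht
    rw [mem_Icc] at ht
    have ht0 : (0 : ℝ) < t := by exact_mod_cast ht.1
    have h1 := (hG t ht.1).le_surplus
    rw [Real.rpow_neg ht0.le, ← div_eq_mul_inv, div_div, le_div_iff₀ (by positivity)]
    linarith
  have h2 := hm.trans (sum_le_sum hlevel)
  rw [← mul_sum] at h2
  have h3 := h2.trans (mul_le_mul_of_nonneg_left (sum_Icc_rpow_neg_le hα T) (by positivity))
  have hTp : 0 < (T : ℝ) ^ (1 - α) := by positivity
  rw [div_mul_eq_mul_div, le_div_iff₀ hc] at h3
  rw [← mul_div_assoc, div_le_iff₀ hTp]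
  linarith

theorem exists_const_le_surplus {k : ℕ} (hk : 1 ≤ k) :
    ∃ c : ℝ, 0 < c ∧ ∀ (V : Type) [Fintype V] (G : SimpleGraph V), G.CliqueFree (k + 2) →
      c * (edgeCount G : ℝ) ^ (((k : ℝ) + 3) / (2 * k + 3)) ≤ surplus G := by
  obtain ⟨c, hc, hstar⟩ := exists_const_hasSurplus_degree (k := k + 1) (by omega)
  refine ⟨min (1 / 256 * (1 / 16) ^ k) (c / 16), by positivity, fun V _ G hG => ?_⟩
  have hs : 0 ≤ surplus G := by simpa using (hasSurplus_zero G univ).le_surplus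
  have hk0 : (1 : ℝ) ≤ k := by exact_mod_cast hk
  rcases Nat.eq_zero_or_pos (edgeCount G) with hm0 | hm0
  · rw [hm0, Nat.cast_zero, Real.zero_rpow (by positivity), mul_zero]
    exact hs
  set m : ℝ := (edgeCount G : ℝ) with hm
  have hm1 : 1 ≤ m := by
    rw [hm]
    exact_mod_cast hm0
  have hm_pos : 0 < m := by linarith
  set d : ℝ := m ^ (((k : ℝ) + 1) / (2 * k + 3)) with hd
  have hd1 : 1 ≤ d := Real.one_le_rpow hm1 (by positivity)
  set T : ℕ := ⌈d⌉₊ with hT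
  have hdT : d ≤ T := Nat.le_ceil d
  have hT2 : (T : ℝ) ≤ 2 * d := by
    have := Nat.ceil_lt_add_one (by linarith : (0 : ℝ) ≤ d)
    linarith
  have hT1 : 1 ≤ T := by exact_mod_cast hd1.trans hdT
  set A : Finset V := {v | T ≤ degIn G univ v} with hA
  by_cases hcase : ∑ v ∈ A, (degIn G A v : ℝ) ≤ 2 * d * #A
  · have hsets := le_surplus_of_level_sets (α := 1 / ((k + 1 : ℕ) : ℝ)) hc
      (by
        rw [div_le_div_iff₀ (by positivity) (by norm_num)]
        push_cast
        linarith) hT1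
      (fun t ht => hstar V G univ hG.cliqueFreeOn t ht) (edgeCount_le_of_sparse hdT hcase)
    refine le_trans ?_ hsets
    have hα : (1 : ℝ) - 1 / ((k + 1 : ℕ) : ℝ) = k / (k + 1) := by
      push_cast
      field_simp
      ring
    have hpow : (T : ℝ) ^ ((k : ℝ) / (k + 1)) ≤ 2 * m ^ ((k : ℝ) / (2 * k + 3)) := by
      calc (T : ℝ) ^ ((k : ℝ) / (k + 1)) ≤ (2 * d) ^ ((k : ℝ) / (k + 1)) :=
            Real.rpow_le_rpow (by positivity) hT2 (by positivity)
        _ = 2 ^ ((k : ℝ) / (k + 1)) * m ^ ((k : ℝ) / (2 * k + 3)) := by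
            rw [Real.mul_rpow (by norm_num) (by linarith), hd, ← Real.rpow_mul hm_pos.le]
            congr 2
            field_simp
        _ ≤ 2 * m ^ ((k : ℝ) / (2 * k + 3)) := by
            refine mul_le_mul_of_nonneg_right ?_ (by positivity)
            refine (Real.rpow_le_rpow_of_exponent_le (by norm_num) ?_).trans
              (Real.rpow_one 2).le
            rw [div_le_one (by positivity)]
            linarith
    have hsplit : m ^ (((k : ℝ) + 3) / (2 * k + 3)) = m / m ^ ((k : ℝ) / (2 * k + 3)) := by
      nth_rewrite 2 [← Real.rpow_one m]
      rw [← Real.rpow_sub hm_pos]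
      congr 1
      field_simp
      ring
    rw [hα]
    calc min (1 / 256 * (1 / 16) ^ k) (c / 16) * m ^ (((k : ℝ) + 3) / (2 * k + 3))
        ≤ c / 16 * m ^ (((k : ℝ) + 3) / (2 * k + 3)) :=
          mul_le_mul_of_nonneg_right (min_le_right _ _) (by positivity)
      _ = c / 8 * (m / (2 * m ^ ((k : ℝ) / (2 * k + 3)))) := by
          rw [hsplit]
          field_simp
          norm_num
      _ ≤ _ := by gcongr
  · push Not at hcase
    have hAne : A.Nonempty := by
      rw [nonempty_iff_ne_empty]
      intro h
      simp [h] at hcase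
    refine le_trans ?_ (le_surplus_of_dense hk hG hAne (by linarith : 0 < d) hcase.le)
    refine mul_le_mul (min_le_left _ _) (le_of_eq ?_) (by positivity) (by positivity)
    rw [hd, ← Real.rpow_natCast, ← Real.rpow_natCast, ← Real.rpow_mul hm_pos.le,
      ← Real.rpow_sub hm_pos, Nat.cast_sub hk]
    congr 1
    push_cast
    field_simp
    ring

end Combine

/-- For every `r ≥ 3` there is `c_r > 0` such that every `K_r`-free graph with `m`
edges has surplus at least `c_r · m^(1/2 + 3/(4r-2))`. -/
theorem statement5 (r : ℕ) (hr : 3 ≤ r) :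
    ∃ c : ℝ, 0 < c ∧
      ∀ (V : Type) [Fintype V] (G : SimpleGraph V),
        G.CliqueFree r →
        surplus G ≥ c * (edgeCount G : ℝ) ^ ((1 : ℝ) / 2 + 3 / (4 * (r : ℝ) - 2)) := by
  obtain ⟨k, rfl⟩ := Nat.exists_eq_add_of_le' (by omega : 2 ≤ r)
  obtain ⟨c, hc, h⟩ := exists_const_le_surplus (k := k) (by omega)
  refine ⟨c, hc, fun V _ G hG => ?_⟩
  have he : (1 : ℝ) / 2 + 3 / (4 * ((k + 2 : ℕ) : ℝ) - 2) = ((k : ℝ) + 3) / (2 * k + 3) := by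
    have h1 : 4 * ((k + 2 : ℕ) : ℝ) - 2 = 2 * (2 * k + 3) := by
      push_cast
      ring
    rw [h1]
    field_simp
    ring
  rw [he]
  exact h V G hG

end MaxCutPaper
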